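/- Let R be a right noetherian ring with findim(R) < ∞, let (A, B) be the cotorsion pair generated by P^{<∞} (i.e. B = (P^{<∞})^{⊥1} and A = ^{⊥1}B), and let ω = A ∩ B be its kernel. Then Findim(R) = findim(R) if and only if pd(ω^∧) = pd(ω), where ω^∧ denotes the class of modules with finite ω-resolution. -/

import Mathlib

noncomputable section

open CategoryTheory CategoryTheory.Limits Opposite DirectSum

universe u

namespace CotorsionDim

variable {R : Type u} [Ring R]

/-- `Ext^n_R(M,N) = 0`. -/
def ExtZero (M N : ModuleCat.{u} R) (n : ℕ) : Prop :=
  IsZero (((Ext ℤ (ModuleCat.{u} R) n).obj (op M)).obj N)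

/-- A pair of composable maps forms a short exact sequence `0 → A → B → C → 0`. -/
def IsSES {A B C : ModuleCat.{u} R} (f : A ⟶ B) (g : B ⟶ C) : Prop :=
  ∃ w : f ≫ g = 0, (CategoryTheory.ShortComplex.mk f g w).ShortExact

/-- relative projective dimension `pd_𝒳(M)` -/
def rpd (𝒳 : Set (ModuleCat.{u} R)) (M : ModuleCat.{u} R) : ℕ∞ :=
  sInf {n : ℕ∞ | ∀ j : ℕ, n < (j : ℕ∞) → ∀ X ∈ 𝒳, ExtZero M X j}

/-- relative injective dimension `id_𝒳(M)` -/
def rid (𝒳 : Set (ModuleCat.{u} R)) (M : ModuleCat.{u} R) : ℕ∞ :=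
  sInf {n : ℕ∞ | ∀ j : ℕ, n < (j : ℕ∞) → ∀ X ∈ 𝒳, ExtZero X M j}

/-- `pd_𝒳(𝒴)` -/
def rpdClass (𝒳 𝒴 : Set (ModuleCat.{u} R)) : ℕ∞ := ⨆ Y : 𝒴, rpd 𝒳 Y

/-- `id_𝒳(𝒴)` -/
def ridClass (𝒳 𝒴 : Set (ModuleCat.{u} R)) : ℕ∞ := ⨆ Y : 𝒴, rid 𝒳 Y

/-- projective dimension -/
def pd (M : ModuleCat.{u} R) : ℕ∞ := rpd Set.univ M

/-- injective dimension -/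
def idim (M : ModuleCat.{u} R) : ℕ∞ := rid Set.univ M

/-- `pd(𝒴)` -/
def pdClass (𝒴 : Set (ModuleCat.{u} R)) : ℕ∞ := ⨆ Y : 𝒴, pd Y.1

/-- `id(𝒴)` -/
def idClass (𝒴 : Set (ModuleCat.{u} R)) : ℕ∞ := ⨆ Y : 𝒴, idim Y.1

/-- `M` has an `𝒳`-resolution `0 → X_n → ⋯ → X_0 → M → 0` of length `n`. -/
def HasResLen (𝒳 : Set (ModuleCat.{u} R)) : ℕ → ModuleCat.{u} R → Prop
  | 0, M => M ∈ 𝒳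
  | n+1, M => ∃ (K X : ModuleCat.{u} R) (f : K ⟶ X) (g : X ⟶ M),
      X ∈ 𝒳 ∧ IsSES f g ∧ HasResLen 𝒳 n K

/-- `M` has an `𝒳`-coresolution `0 → M → X_0 → ⋯ → X_n → 0` of length `n`. -/
def HasCoresLen (𝒳 : Set (ModuleCat.{u} R)) : ℕ → ModuleCat.{u} R → Prop
  | 0, M => M ∈ 𝒳
  | n+1, M => ∃ (X C : ModuleCat.{u} R) (f : M ⟶ X) (g : X ⟶ C),
      X ∈ 𝒳 ∧ IsSES f g ∧ HasCoresLen 𝒳 n C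

/-- `resdim_𝒳(M)` -/
def resdim (𝒳 : Set (ModuleCat.{u} R)) (M : ModuleCat.{u} R) : ℕ∞ :=
  ⨅ n : {n : ℕ // HasResLen 𝒳 n M}, (n : ℕ∞)

/-- `coresdim_𝒳(M)` -/
def coresdim (𝒳 : Set (ModuleCat.{u} R)) (M : ModuleCat.{u} R) : ℕ∞ :=
  ⨅ n : {n : ℕ // HasCoresLen 𝒳 n M}, (n : ℕ∞)

/-- `resdim_𝒳(𝒴)` -/
def resdimClass (𝒳 𝒴 : Set (ModuleCat.{u} R)) : ℕ∞ := ⨆ Y : 𝒴, resdim 𝒳 Y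

/-- `coresdim_𝒳(𝒴)` -/
def coresdimClass (𝒳 𝒴 : Set (ModuleCat.{u} R)) : ℕ∞ := ⨆ Y : 𝒴, coresdim 𝒳 Y

/-- `𝒳^∧`, the class of modules with a finite `𝒳`-resolution. -/
def resClosure (𝒳 : Set (ModuleCat.{u} R)) : Set (ModuleCat.{u} R) :=
  {M | ∃ n, HasResLen 𝒳 n M}

/-- `𝒳^∨`, the class of modules with a finite `𝒳`-coresolution. -/
def coresClosure (𝒳 : Set (ModuleCat.{u} R)) : Set (ModuleCat.{u} R) :=
  {M | ∃ n, HasCoresLen 𝒳 n M}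

/-- `(𝒜, ℬ)` is a cotorsion pair. -/
def IsCotorsionPair (𝒜 ℬ : Set (ModuleCat.{u} R)) : Prop :=
  (∀ M, M ∈ 𝒜 ↔ ∀ B ∈ ℬ, ExtZero M B 1) ∧
  (∀ M, M ∈ ℬ ↔ ∀ A ∈ 𝒜, ExtZero A M 1)

/-- completeness of a cotorsion pair -/
def IsComplete (𝒜 ℬ : Set (ModuleCat.{u} R)) : Prop :=
  ∀ M : ModuleCat.{u} R,
    (∃ (B A : ModuleCat.{u} R) (f : B ⟶ A) (g : A ⟶ M), B ∈ ℬ ∧ A ∈ 𝒜 ∧ IsSES f g) ∧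
    (∃ (B A : ModuleCat.{u} R) (f : M ⟶ B) (g : B ⟶ A), B ∈ ℬ ∧ A ∈ 𝒜 ∧ IsSES f g)

/-- heredity of a cotorsion pair -/
def IsHereditary (𝒜 ℬ : Set (ModuleCat.{u} R)) : Prop :=
  ∀ i : ℕ, 1 ≤ i → ∀ A ∈ 𝒜, ∀ B ∈ ℬ, ExtZero A B i

variable (R)

/-- `𝒫`, the class of modules of finite projective dimension. -/
def P : Set (ModuleCat.{u} R) := {M | pd M < ⊤}

variable {R}

/-- `M` admits a projective resolution consisting of finitely generated projectives,
i.e. `M ∈ mod R`. -/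
def InmodR (M : ModuleCat.{u} R) : Prop :=
  ∃ K : ℕ → ModuleCat.{u} R, K 0 = M ∧ ∀ i : ℕ,
    ∃ (Q : ModuleCat.{u} R) (f : K (i+1) ⟶ Q) (g : Q ⟶ K i),
      Module.Finite R Q ∧ Projective Q ∧ IsSES f g

variable (R)

/-- `𝒫^{<∞} = 𝒫 ∩ mod R`. -/
def Pfin : Set (ModuleCat.{u} R) := {M | pd M < ⊤ ∧ InmodR M}

/-- the big finitistic dimension -/
def bigFindim : ℕ∞ := pdClass (P R)

/-- the little finitistic dimension -/
def littleFindim : ℕ∞ := pdClass (Pfin R)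

variable {R}

/-- `𝒳^{⊥₁}` -/
def rperp1 (𝒳 : Set (ModuleCat.{u} R)) : Set (ModuleCat.{u} R) :=
  {M | ∀ X ∈ 𝒳, ExtZero X M 1}

/-- `^{⊥₁}𝒳` -/
def lperp1 (𝒳 : Set (ModuleCat.{u} R)) : Set (ModuleCat.{u} R) :=
  {M | ∀ X ∈ 𝒳, ExtZero M X 1}

/-- `T^⊥ = {M : Ext^i(T,M) = 0 for all i > 0}` -/
def rperpAll (T : ModuleCat.{u} R) : Set (ModuleCat.{u} R) :=
  {M | ∀ i : ℕ, 0 < i → ExtZero T M i}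

/-- `Add T`: direct summands of arbitrary direct sums of copies of `T`. -/
def AddT (T : ModuleCat.{u} R) : Set (ModuleCat.{u} R) :=
  {M | ∃ (I : Type u) (s : M ⟶ ModuleCat.of R (I →₀ T)) (r : ModuleCat.of R (I →₀ T) ⟶ M),
    s ≫ r = 𝟙 M}

/-- `T` is a tilting module. -/
def IsTilting (T : ModuleCat.{u} R) : Prop :=
  pd T < ⊤ ∧
  (∀ i : ℕ, 0 < i → ∀ I : Type u, ExtZero T (ModuleCat.of R (I →₀ T)) i) ∧
  ∃ n, HasCoresLen (AddT T) n (ModuleCat.of R R)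


/-- `𝒳` is closed under arbitrary direct sums (coproducts). -/
def ClosedUnderCoproducts (𝒳 : Set (ModuleCat.{u} R)) : Prop :=
  ∀ (I : Type u) (f : I → ModuleCat.{u} R), (∀ i, f i ∈ 𝒳) →
    ModuleCat.of R (⨁ i, (f i : Type u)) ∈ 𝒳

/-- `𝒳` is closed under direct summands. -/
def ClosedUnderSummands (𝒳 : Set (ModuleCat.{u} R)) : Prop :=
  ∀ (M N : ModuleCat.{u} R) (s : M ⟶ N) (r : N ⟶ M), s ≫ r = 𝟙 M → N ∈ 𝒳 → M ∈ 𝒳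


section ExtLemmas

variable {C : Type*} [Category* C] [Abelian C] [HasExt.{u} C]
  {S : ShortComplex C}

lemma subsingleton_ext_X₂_left (hS : S.ShortExact) {Y : C} {n : ℕ}
    (h₁ : Subsingleton (Abelian.Ext S.X₁ Y n))
    (h₃ : Subsingleton (Abelian.Ext S.X₃ Y n)) : Subsingleton (Abelian.Ext S.X₂ Y n) := by
  refine subsingleton_of_forall_eq 0 fun x ↦ ?_
  obtain ⟨y, rfl⟩ := Abelian.Ext.contravariant_sequence_exact₂ hS Y x (Subsingleton.elim _ _)
  rw [Subsingleton.elim y 0, Abelian.Ext.comp_zero]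

lemma subsingleton_ext_X₃_left (hS : S.ShortExact) {Y : C} {n : ℕ}
    (h₁ : Subsingleton (Abelian.Ext S.X₁ Y n))
    (h₂ : Subsingleton (Abelian.Ext S.X₂ Y (n + 1))) :
    Subsingleton (Abelian.Ext S.X₃ Y (n + 1)) := by
  refine subsingleton_of_forall_eq 0 fun x ↦ ?_
  obtain ⟨y, rfl⟩ := Abelian.Ext.contravariant_sequence_exact₃ hS Y x (Subsingleton.elim _ _)
    (add_comm 1 n)
  rw [Subsingleton.elim y 0, Abelian.Ext.comp_zero]

lemma subsingleton_ext_X₁_left (hS : S.ShortExact) {Y : C} {n : ℕ}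
    (h₂ : Subsingleton (Abelian.Ext S.X₂ Y n))
    (h₃ : Subsingleton (Abelian.Ext S.X₃ Y (n + 1))) :
    Subsingleton (Abelian.Ext S.X₁ Y n) := by
  refine subsingleton_of_forall_eq 0 fun x ↦ ?_
  obtain ⟨y, rfl⟩ := Abelian.Ext.contravariant_sequence_exact₁ hS Y x (add_comm 1 n)
    (Subsingleton.elim _ _)
  rw [Subsingleton.elim y 0, Abelian.Ext.comp_zero]

lemma subsingleton_ext_X₂_right (hS : S.ShortExact) {X : C} {n : ℕ}
    (h₁ : Subsingleton (Abelian.Ext X S.X₁ n))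
    (h₃ : Subsingleton (Abelian.Ext X S.X₃ n)) : Subsingleton (Abelian.Ext X S.X₂ n) := by
  refine subsingleton_of_forall_eq 0 fun x ↦ ?_
  obtain ⟨y, rfl⟩ := Abelian.Ext.covariant_sequence_exact₂ X hS x (Subsingleton.elim _ _)
  rw [Subsingleton.elim y 0, Abelian.Ext.zero_comp]

lemma subsingleton_ext_X₃_right (hS : S.ShortExact) {X : C} {n : ℕ}
    (h₂ : Subsingleton (Abelian.Ext X S.X₂ n))
    (h₁ : Subsingleton (Abelian.Ext X S.X₁ (n + 1))) :
    Subsingleton (Abelian.Ext X S.X₃ n) := by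
  refine subsingleton_of_forall_eq 0 fun x ↦ ?_
  obtain ⟨y, rfl⟩ := Abelian.Ext.covariant_sequence_exact₃ X hS x rfl (Subsingleton.elim _ _)
  rw [Subsingleton.elim y 0, Abelian.Ext.zero_comp]

lemma subsingleton_ext_X₁_right (hS : S.ShortExact) {X : C} {n : ℕ}
    (h₃ : Subsingleton (Abelian.Ext X S.X₃ n))
    (h₂ : Subsingleton (Abelian.Ext X S.X₂ (n + 1))) :
    Subsingleton (Abelian.Ext X S.X₁ (n + 1)) := by
  refine subsingleton_of_forall_eq 0 fun x ↦ ?_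
  obtain ⟨y, rfl⟩ := Abelian.Ext.covariant_sequence_exact₁ X hS x (Subsingleton.elim _ _) rfl
  rw [Subsingleton.elim y 0, Abelian.Ext.zero_comp]

lemma exists_extension_of_subsingleton_ext (hS : S.ShortExact) {N : C}
    (h : Subsingleton (Abelian.Ext S.X₃ N 1))
    (f : S.X₁ ⟶ N) : ∃ g : S.X₂ ⟶ N, S.f ≫ g = f := by
  obtain ⟨y, hy⟩ := Abelian.Ext.contravariant_sequence_exact₁ hS N (Abelian.Ext.mk₀ f)
    (add_zero 1) (Subsingleton.elim _ _)
  obtain ⟨g, rfl⟩ := Abelian.Ext.mk₀_bijective _ _ |>.2 y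
  exact ⟨g, (Abelian.Ext.mk₀_bijective _ _).1 (by rw [← hy, Abelian.Ext.mk₀_comp_mk₀])⟩

lemma subsingleton_ext_of_exists_extension (hS : S.ShortExact) {N : C}
    (h₂ : Subsingleton (Abelian.Ext S.X₂ N 1))
    (h : ∀ f : S.X₁ ⟶ N, ∃ g : S.X₂ ⟶ N, S.f ≫ g = f) :
    Subsingleton (Abelian.Ext S.X₃ N 1) := by
  refine subsingleton_of_forall_eq 0 fun x ↦ ?_
  obtain ⟨y, rfl⟩ := Abelian.Ext.contravariant_sequence_exact₃ hS N x (Subsingleton.elim _ _)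
    (add_zero 1)
  obtain ⟨f, rfl⟩ := Abelian.Ext.mk₀_bijective _ _ |>.2 y
  obtain ⟨g, rfl⟩ := h f
  rw [← Abelian.Ext.mk₀_comp_mk₀, hS.extClass_comp_assoc]

lemma subsingleton_ext_of_exists_lift (hS : S.ShortExact) {X : C}
    (h₂ : Subsingleton (Abelian.Ext X S.X₂ 1))
    (h : ∀ f : X ⟶ S.X₃, ∃ g : X ⟶ S.X₂, g ≫ S.g = f) :
    Subsingleton (Abelian.Ext X S.X₁ 1) := by
  refine subsingleton_of_forall_eq 0 fun x ↦ ?_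
  obtain ⟨y, rfl⟩ := Abelian.Ext.covariant_sequence_exact₁ X hS x (Subsingleton.elim _ _)
    (zero_add 1)
  obtain ⟨f, rfl⟩ := Abelian.Ext.mk₀_bijective _ _ |>.2 y
  obtain ⟨g, rfl⟩ := h f
  rw [← Abelian.Ext.mk₀_comp_mk₀, Abelian.Ext.comp_assoc_of_second_deg_zero, hS.comp_extClass,
    Abelian.Ext.comp_zero]

end ExtLemmas

section

variable {C : Type*} [Category* C] [Abelian C]

lemma shortExact_cosyzygy [EnoughInjectives C] (N : C) :
    (ShortComplex.mk (Injective.ι N) (cokernel.π (Injective.ι N)) (by simp)).ShortExact :=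
  { exact := ShortComplex.exact_of_g_is_cokernel _ (cokernelIsCokernel _) }

lemma subsingleton_ext_of_projective [HasExt.{u} C] (X Y : C) [Projective X] (n : ℕ) :
    Subsingleton (Abelian.Ext X Y (n + 1)) :=
  HasProjectiveDimensionLT.subsingleton X 1 (n + 1) (by lia) Y

end

lemma extZero_succ_iff (M N : ModuleCat.{u} R) (n : ℕ) :
    ExtZero M N (n + 1) ↔ Subsingleton (Abelian.Ext M N (n + 1)) := by
  let Q := ProjectiveResolution.of M
  have h : ExtZero M N (n + 1) ↔ ∀ f : Q.complex.X (n + 1) ⟶ N,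
      Q.complex.d (n + 2) (n + 1) ≫ f = 0 → ∃ g : Q.complex.X n ⟶ N, Q.complex.d (n + 1) n ≫ g = f := by
    unfold ExtZero
    rw [(Q.isoExt (R := ℤ) (n + 1) N).isZero_iff, ← HomologicalComplex.exactAt_iff_isZero_homology,
      HomologicalComplex.exactAt_iff' _ n (n + 1) (n + 2) (by simp) (by simp),
      ShortComplex.moduleCat_exact_iff]
    rfl
  rw [h]
  constructor
  · intro h
    refine subsingleton_of_forall_eq 0 fun x ↦ ?_
    obtain ⟨f, hf, rfl⟩ := Q.extMk_surjective x (n + 2) rfl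
    exact (Q.extMk_eq_zero_iff f (n + 2) rfl hf n rfl).2 (h f hf)
  · intro h f hf
    exact (Q.extMk_eq_zero_iff f (n + 2) rfl hf n rfl).1 (Subsingleton.elim _ _)

lemma mem_rperp1_iff {𝒳 : Set (ModuleCat.{u} R)} {M : ModuleCat.{u} R} :
    M ∈ rperp1 𝒳 ↔ ∀ X ∈ 𝒳, Subsingleton (Abelian.Ext X M 1) :=
  forall₂_congr fun X _ ↦ extZero_succ_iff X M 0

lemma mem_lperp1_iff {𝒳 : Set (ModuleCat.{u} R)} {M : ModuleCat.{u} R} :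
    M ∈ lperp1 𝒳 ↔ ∀ X ∈ 𝒳, Subsingleton (Abelian.Ext M X 1) :=
  forall₂_congr fun X _ ↦ extZero_succ_iff M X 0

lemma pd_le_iff {M : ModuleCat.{u} R} {n : ℕ} :
    pd M ≤ n ↔ HasProjectiveDimensionLE M n := by
  have h : pd M ≤ n ↔ ∀ j : ℕ, (n : ℕ∞) < j → ∀ X ∈ Set.univ, ExtZero M X j := by
    refine ⟨fun h j hj ↦ ?_, fun h ↦ sInf_le h⟩
    have hmem : rpd Set.univ M ∈ {n : ℕ∞ | ∀ j : ℕ, n < (j : ℕ∞) → ∀ X ∈ Set.univ, ExtZero M X j} :=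
      csInf_mem ⟨⊤, fun j hj ↦ absurd hj not_top_lt⟩
    exact hmem j (h.trans_lt hj)
  rw [h]
  constructor
  · intro h
    refine HasProjectiveDimensionLT.mk fun i hi Y e ↦ ?_
    obtain ⟨i, rfl⟩ : ∃ k, i = k + 1 := ⟨i - 1, by lia⟩
    have := (extZero_succ_iff M Y i).1 (h (i + 1) (by exact_mod_cast hi) Y trivial)
    exact Subsingleton.elim _ _
  · intro h j hj X _
    obtain ⟨i, rfl⟩ : ∃ k, j = k + 1 := Nat.exists_eq_succ_of_ne_zero (by rintro rfl; simp at hj)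
    rw [extZero_succ_iff]
    exact HasProjectiveDimensionLT.subsingleton M (n + 1) _ (by exact_mod_cast hj) X

lemma pd_lt_top_iff {M : ModuleCat.{u} R} : pd M < ⊤ ↔ ∃ n : ℕ, HasProjectiveDimensionLE M n := by
  simp_rw [← pd_le_iff]
  exact ⟨fun h ↦ ⟨(pd M).toNat, (ENat.natCast_toNat h.ne).ge⟩,
    fun ⟨n, h⟩ ↦ h.trans_lt (ENat.natCast_lt_top n)⟩

lemma pdClass_le_iff {𝒴 : Set (ModuleCat.{u} R)} {n : ℕ} :
    pdClass 𝒴 ≤ n ↔ ∀ M ∈ 𝒴, HasProjectiveDimensionLE M n := by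
  simp [pdClass, iSup_le_iff, pd_le_iff]

lemma pdClass_mono {𝒳 𝒴 : Set (ModuleCat.{u} R)} (h : 𝒳 ⊆ 𝒴) : pdClass 𝒳 ≤ pdClass 𝒴 :=
  iSup_le fun X ↦ le_iSup (fun Y : 𝒴 ↦ pd Y.1) ⟨X.1, h X.2⟩

section SmallObject

open MorphismProperty

lemma hasSmallObjectArgument_of_le_generatingMonomorphisms {C : Type*} [Category.{u} C] [Abelian C]
    [IsGrothendieckAbelian.{u} C] {G : C} {I : MorphismProperty C} [IsSmall.{u} I]
    (hI : I ≤ IsGrothendieckAbelian.generatingMonomorphisms G) : HasSmallObjectArgument.{u} I := by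
  obtain ⟨κ, hκ', hκ⟩ := HasCardinalLT.exists_regular_cardinal.{u} (Subobject G)
  have : Fact κ.IsRegular := ⟨hκ'⟩
  have : Nonempty κ.ord.ToType := by simpa using hκ'.ne_zero
  have := WellFoundedLT.toOrderBot κ.ord.ToType
  exact ⟨κ, inferInstance, inferInstance,
    { preservesColimit {A B X Y} i hi f hf := by
        let hf' : (monomorphisms C).TransfiniteCompositionOfShape κ.ord.ToType f :=
          { toTransfiniteCompositionOfShape := hf.toTransfiniteCompositionOfShape
            map_mem j hj := by
              have := (hf.attachCells j hj).pushouts_coproducts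
              simp only [ofHoms_homFamily] at this
              refine (?_ : _ ≤ monomorphisms C) _ this
              simp only [pushouts_le_iff, coproducts_le_iff]
              exact hI.trans (IsGrothendieckAbelian.generatingMonomorphisms_le_monomorphisms G) }
        have (j j' : κ.ord.ToType) (φ : j ⟶ j') : Mono (hf'.F.map φ) := hf'.mem_map φ
        apply IsGrothendieckAbelian.preservesColimit_coyoneda_obj_of_mono (Y := hf'.F) (κ := κ)
        obtain ⟨S⟩ := hI _ hi
        exact Subobject.hasCardinalLT_of_mono hκ S.arrow }⟩

end SmallObject

section Approximation

open MorphismProperty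

variable (𝒳 : Set (ModuleCat.{u} R)) (G : ModuleCat.{u} R)

/-- The inclusions into `G` of the subobjects whose cokernel lies in `𝒳`. -/
def generatingInclusions : MorphismProperty (ModuleCat.{u} R) :=
  ofHoms fun S : {S : Subobject G // ∃ X ∈ 𝒳, ∃ g : G ⟶ X, IsSES S.arrow g} ↦ S.1.arrow

lemma generatingInclusions_le :
    generatingInclusions 𝒳 G ≤ IsGrothendieckAbelian.generatingMonomorphisms G := by
  rintro _ _ _ ⟨S⟩
  exact ⟨S.1⟩

instance : IsSmall.{u} (generatingInclusions 𝒳 G) := isSmall_ofHoms _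

instance : HasSmallObjectArgument.{u} (generatingInclusions 𝒳 G) :=
  hasSmallObjectArgument_of_le_generatingMonomorphisms (generatingInclusions_le 𝒳 G)

variable {𝒳 G}

lemma rlp_generatingInclusions_of_injective {J Z : ModuleCat.{u} R} [Injective J] (hZ : IsZero Z)
    (p : J ⟶ Z) : (generatingInclusions 𝒳 G).rlp p := by
  intro A B i hi
  have : Mono i := IsGrothendieckAbelian.generatingMonomorphisms_le_monomorphisms G _
    (generatingInclusions_le 𝒳 G _ hi)
  exact Injective.hasLiftingProperty_of_isZero i p hZ

lemma rlp_generatingInclusions_of_shortExact [Projective G]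
    {S : ShortComplex (ModuleCat.{u} R)} (hS : S.ShortExact) (hN : S.X₁ ∈ rperp1 𝒳) :
    (generatingInclusions 𝒳 G).rlp S.g := by
  rintro _ _ _ ⟨⟨K, X, hX, g, w, hK⟩⟩
  constructor
  intro a b sq
  have := hS.epi_g
  have := hS.mono_f
  let b' := Projective.factorThru b S.g
  let d : (K : ModuleCat.{u} R) ⟶ S.X₁ := hS.exact.lift (a - K.arrow ≫ b') (by
    rw [Preadditive.sub_comp, Category.assoc, Projective.factorThru_comp, sq.w, sub_self])
  obtain ⟨e, he⟩ := exists_extension_of_subsingleton_ext hK (mem_rperp1_iff.1 hN X hX) d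
  dsimp only at he
  refine ⟨⟨⟨b' + e ≫ S.f, ?_, ?_⟩⟩⟩
  · dsimp only
    rw [Preadditive.comp_add, reassoc_of% he, hS.exact.lift_f]
    abel
  · rw [Preadditive.add_comp, Category.assoc, S.zero, comp_zero, add_zero,
      Projective.factorThru_comp]

lemma mem_rperp1_of_rlp_generatingInclusions [Projective G]
    (hG : ∀ X ∈ 𝒳, ∃ g : G ⟶ X, Epi g) {B Z : ModuleCat.{u} R} (hZ : IsZero Z) {p : B ⟶ Z}
    (hp : (generatingInclusions 𝒳 G).rlp p) : B ∈ rperp1 𝒳 := by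
  rw [mem_rperp1_iff]
  intro X hX
  obtain ⟨g, hg⟩ := hG X hX
  have w : (kernelSubobject g).arrow ≫ g = 0 := kernelSubobject_arrow_comp g
  have hS : (ShortComplex.mk _ g w).ShortExact :=
    { exact := ShortComplex.exact_of_f_is_kernel _
        (IsLimit.ofIsoLimit (kernelIsKernel g) (Fork.ext (kernelSubobjectIso g).symm (by simp))) }
  refine subsingleton_ext_of_exists_extension hS (subsingleton_ext_of_projective G B 0) fun f ↦ ?_
  have : HasLiftingProperty (kernelSubobject g).arrow p :=
    hp _ (ofHoms.mk (⟨kernelSubobject g, X, hX, g, w, hS⟩ :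
      {S : Subobject G // ∃ X ∈ 𝒳, ∃ g : G ⟶ X, IsSES S.arrow g}))
  have sq : CommSq f (kernelSubobject g).arrow p 0 := ⟨hZ.eq_of_tgt _ _⟩
  exact ⟨sq.lift, sq.fac_left⟩

lemma exists_special_preenvelope [Projective G] (hG : ∀ X ∈ 𝒳, ∃ g : G ⟶ X, Epi g)
    (M : ModuleCat.{u} R) :
    ∃ (B A : ModuleCat.{u} R) (f : M ⟶ B) (g : B ⟶ A),
      B ∈ rperp1 𝒳 ∧ A ∈ lperp1 (rperp1 𝒳) ∧ IsSES f g := by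
  let I := generatingInclusions 𝒳 G
  let fac := (functorialFactorizationData I.rlp.llp I.rlp).factorizationData
    (0 : M ⟶ ModuleCat.of R PUnit)
  have hZ : IsZero (ModuleCat.of R PUnit.{u + 1}) := ModuleCat.isZero_of_subsingleton _
  have : Mono fac.i := by
    have : HasLiftingProperty fac.i (0 : Injective.under M ⟶ ModuleCat.of R PUnit.{u + 1}) :=
      fac.hi _ (rlp_generatingInclusions_of_injective hZ _)
    have sq : CommSq (Injective.ι M) fac.i (0 : Injective.under M ⟶ ModuleCat.of R PUnit.{u + 1})
      0 := ⟨hZ.eq_of_tgt _ _⟩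
    have : Mono (fac.i ≫ sq.lift) := by
      rw [sq.fac_left]
      infer_instance
    exact mono_of_mono fac.i sq.lift
  refine ⟨fac.Z, cokernel fac.i, fac.i, cokernel.π fac.i,
    mem_rperp1_of_rlp_generatingInclusions hG hZ fac.hp, ?_, cokernel.condition _,
    { exact := ShortComplex.exact_of_g_is_cokernel _ (cokernelIsCokernel _) }⟩
  rw [mem_lperp1_iff]
  intro N hN
  refine subsingleton_ext_of_exists_lift (shortExact_cosyzygy N)
    (Abelian.Ext.subsingleton_of_injective _ _ 0) fun f ↦ ?_
  have : HasLiftingProperty fac.i (cokernel.π (Injective.ι N)) :=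
    fac.hi _ (rlp_generatingInclusions_of_shortExact (shortExact_cosyzygy N) hN)
  have sq : CommSq 0 fac.i (cokernel.π (Injective.ι N)) (cokernel.π fac.i ≫ f) := ⟨by simp⟩
  refine ⟨cokernel.desc fac.i sq.lift (by simp), ?_⟩
  rw [← cancel_epi (cokernel.π fac.i), cokernel.π_desc_assoc, sq.fac_right]

end Approximation

lemma exists_shortExact_of_isPushout {C : Type*} [Category* C] [Abelian C] {S : ShortComplex C}
    (hS : S.ShortExact) {Y Z : C} {f : S.X₁ ⟶ Y} {inl : S.X₂ ⟶ Z} {inr : Y ⟶ Z}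
    (sq : IsPushout S.f f inl inr) :
    ∃ (g : Z ⟶ S.X₃) (w : inr ≫ g = 0), (ShortComplex.mk inr g w).ShortExact := by
  have := hS.mono_f
  have := hS.epi_g
  have : Mono inr :=
    (MorphismProperty.monomorphisms C).of_isPushout sq.flip
      (MorphismProperty.monomorphisms.infer_property _)
  let g : Z ⟶ S.X₃ := sq.desc S.g 0 (by simp)
  have hl : inl ≫ g = S.g := sq.inl_desc _ _ _
  have hr : inr ≫ g = 0 := sq.inr_desc _ _ _
  have : Epi g := epi_of_epi_fac hl
  have hex : (ShortComplex.mk inr g hr).Exact := by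
    refine ShortComplex.exact_of_g_is_cokernel _ (CokernelCofork.IsColimit.ofπ' g hr
      fun {T} k hk ↦ ⟨hS.exact.desc (inl ≫ k) ?_, ?_⟩)
    · rw [sq.w_assoc, hk, comp_zero]
    · apply sq.hom_ext
      · rw [reassoc_of% hl, hS.exact.g_desc]
      · rw [reassoc_of% hr, zero_comp, hk]
  exact ⟨g, hr, { exact := hex }⟩

lemma exists_special_precover {𝒳 : Set (ModuleCat.{u} R)} {G : ModuleCat.{u} R} [Projective G]
    (hG : ∀ X ∈ 𝒳, ∃ g : G ⟶ X, Epi g) (M : ModuleCat.{u} R) :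
    ∃ (B A : ModuleCat.{u} R) (f : B ⟶ A) (g : A ⟶ M),
      B ∈ rperp1 𝒳 ∧ A ∈ lperp1 (rperp1 𝒳) ∧ IsSES f g := by
  have hM : (ShortComplex.mk _ _ (kernel.condition (Projective.π M))).ShortExact :=
    { exact := ShortComplex.exact_of_f_is_kernel _ (kernelIsKernel _) }
  obtain ⟨B, A, f, g, hB, hA, w, hf⟩ := exists_special_preenvelope hG (kernel (Projective.π M))
  have sq := IsPushout.of_hasPushout (kernel.ι (Projective.π M)) f
  obtain ⟨p, hp⟩ := exists_shortExact_of_isPushout hM sq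
  obtain ⟨q, hq, hq'⟩ := exists_shortExact_of_isPushout hf sq.flip
  refine ⟨B, _, _, p, hB, ?_, hp⟩
  rw [mem_lperp1_iff] at hA ⊢
  exact fun N hN ↦ subsingleton_ext_X₂_left hq' (subsingleton_ext_of_projective _ N 0) (hA N hN)

section Cotorsion

variable {𝒳 : Set (ModuleCat.{u} R)}

lemma subsingleton_ext_of_mem_lperp1_rperp1 {A N : ModuleCat.{u} R}
    (hA : A ∈ lperp1 (rperp1 𝒳)) (n : ℕ)
    (hN : ∀ X ∈ 𝒳, Subsingleton (Abelian.Ext X N (n + 1))) :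
    Subsingleton (Abelian.Ext A N (n + 1)) := by
  induction n generalizing N with
  | zero => exact mem_lperp1_iff.1 hA N (mem_rperp1_iff.2 hN)
  | succ n ih =>
    exact subsingleton_ext_X₁_right (shortExact_cosyzygy N)
      (ih fun X hX ↦ subsingleton_ext_X₃_right (shortExact_cosyzygy N)
        (Abelian.Ext.subsingleton_of_injective _ _ _) (hN X hX))
      (Abelian.Ext.subsingleton_of_injective _ _ _)

lemma hasProjectiveDimensionLE_of_mem_lperp1_rperp1 {A : ModuleCat.{u} R}
    (hA : A ∈ lperp1 (rperp1 𝒳)) {n : ℕ} (h𝒳 : ∀ X ∈ 𝒳, HasProjectiveDimensionLE X n) :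
    HasProjectiveDimensionLE A n :=
  hasProjectiveDimensionLT_of_enoughInjectives A (n + 1) fun N ↦
    subsingleton_ext_of_mem_lperp1_rperp1 hA n fun X hX ↦
      have := h𝒳 X hX
      HasProjectiveDimensionLT.subsingleton X (n + 1) (n + 1) le_rfl N

lemma subset_lperp1_rperp1 : 𝒳 ⊆ lperp1 (rperp1 𝒳) := fun X hX _ hN ↦ hN X hX

lemma subsingleton_ext_of_mem_rperp1
    (hsyz : ∀ X ∈ 𝒳, ∃ (K Q : ModuleCat.{u} R) (f : K ⟶ Q) (g : Q ⟶ X),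
      K ∈ 𝒳 ∧ Projective Q ∧ IsSES f g)
    {X B : ModuleCat.{u} R} (hX : X ∈ 𝒳) (hB : B ∈ rperp1 𝒳) (n : ℕ) :
    Subsingleton (Abelian.Ext X B (n + 1)) := by
  induction n generalizing X with
  | zero => exact mem_rperp1_iff.1 hB X hX
  | succ n ih =>
    obtain ⟨K, Q, f, g, hK, hQ, w, hS⟩ := hsyz X hX
    exact subsingleton_ext_X₃_left hS (ih hK) (subsingleton_ext_of_projective Q B _)

lemma hasResLen_of_subsingleton_ext {G : ModuleCat.{u} R} [Projective G]
    (hG : ∀ X ∈ 𝒳, ∃ g : G ⟶ X, Epi g)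
    (hsyz : ∀ X ∈ 𝒳, ∃ (K Q : ModuleCat.{u} R) (f : K ⟶ Q) (g : Q ⟶ X),
      K ∈ 𝒳 ∧ Projective Q ∧ IsSES f g)
    {B : ModuleCat.{u} R} (hB : B ∈ rperp1 𝒳) (n : ℕ)
    (h : ∀ N ∈ rperp1 𝒳, Subsingleton (Abelian.Ext B N (n + 1))) :
    HasResLen (lperp1 (rperp1 𝒳) ∩ rperp1 𝒳) n B := by
  induction n generalizing B with
  | zero => exact ⟨mem_lperp1_iff.2 h, hB⟩
  | succ n ih =>
    obtain ⟨K, A, f, g, hK, hA, w, hS⟩ := exists_special_precover hG B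
    refine ⟨K, A, f, g, ⟨hA, mem_rperp1_iff.2 fun X hX ↦ ?_⟩, ⟨w, hS⟩, ih hK fun N hN ↦ ?_⟩
    · exact subsingleton_ext_X₂_right hS (mem_rperp1_iff.1 hK X hX) (mem_rperp1_iff.1 hB X hX)
    · exact subsingleton_ext_X₁_left hS (subsingleton_ext_of_mem_lperp1_rperp1 hA n
        fun X hX ↦ subsingleton_ext_of_mem_rperp1 hsyz hX hN n) (h N hN)

lemma hasProjectiveDimensionLE_of_kernel {G : ModuleCat.{u} R} [Projective G]
    (hG : ∀ X ∈ 𝒳, ∃ g : G ⟶ X, Epi g) {m : ℕ}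
    (hω : ∀ M ∈ lperp1 (rperp1 𝒳) ∩ rperp1 𝒳, HasProjectiveDimensionLE M m) (d : ℕ)
    (h : ∀ A ∈ lperp1 (rperp1 𝒳), HasProjectiveDimensionLE A (m + d)) :
    ∀ A ∈ lperp1 (rperp1 𝒳), HasProjectiveDimensionLE A m := by
  induction d with
  | zero => exact h
  | succ d ih =>
    refine ih fun A hA ↦ ?_
    obtain ⟨B, A', f, g, hB, hA', w, hS⟩ := exists_special_preenvelope hG A
    have hB' : B ∈ lperp1 (rperp1 𝒳) := mem_lperp1_iff.2 fun N hN ↦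
      subsingleton_ext_X₂_left hS (mem_lperp1_iff.1 hA N hN) (mem_lperp1_iff.1 hA' N hN)
    have : HasProjectiveDimensionLT B (m + 1) := hω B ⟨hB', hB⟩
    exact hS.hasProjectiveDimensionLT_X₁ (m + d + 1)
      (hasProjectiveDimensionLT_of_ge B (m + 1) _ (by lia)) (h A' hA')

end Cotorsion

lemma resClosure_subset_P {𝒳 : Set (ModuleCat.{u} R)} (h𝒳 : 𝒳 ⊆ P R) : resClosure 𝒳 ⊆ P R := by
  rintro M ⟨n, hM⟩
  induction n generalizing M with
  | zero => exact h𝒳 hM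
  | succ n ih =>
    obtain ⟨K, X, f, g, hX, ⟨w, hS⟩, hK⟩ := hM
    obtain ⟨a, ha⟩ := pd_lt_top_iff.1 (h𝒳 hX)
    obtain ⟨b, hb⟩ := pd_lt_top_iff.1 (ih hK)
    exact pd_lt_top_iff.2 ⟨a + b + 1, hS.hasProjectiveDimensionLT_X₃ (a + b + 1)
      (hasProjectiveDimensionLT_of_ge K (b + 1) _ (by lia))
      (hasProjectiveDimensionLT_of_ge X (a + 1) _ (by lia))⟩

lemma exists_syzygy_mem_Pfin (X : ModuleCat.{u} R) (hX : X ∈ Pfin R) :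
    ∃ (K Q : ModuleCat.{u} R) (f : K ⟶ Q) (g : Q ⟶ X),
      K ∈ Pfin R ∧ Projective Q ∧ IsSES f g := by
  obtain ⟨hpd, K, rfl, hK⟩ := hX
  obtain ⟨Q, f, g, _, hQ, w, hS⟩ := hK 0
  obtain ⟨n, hn⟩ := pd_lt_top_iff.1 hpd
  exact ⟨K 1, Q, f, g, ⟨pd_lt_top_iff.2 ⟨n, hS.hasProjectiveDimensionLT_X₁ (n + 1)
    (hasProjectiveDimensionLT_of_ge Q 1 _ (by lia)) (hasProjectiveDimensionLT_of_ge _ (n + 1) _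
      (by lia))⟩, fun i ↦ K (i + 1), rfl, fun i ↦ hK (i + 1)⟩, hQ, w, hS⟩

lemma exists_epi_of_mem_Pfin (X : ModuleCat.{u} R) (hX : X ∈ Pfin R) :
    ∃ g : ModuleCat.of R (ℕ →₀ R) ⟶ X, Epi g := by
  obtain ⟨-, K, rfl, hK⟩ := hX
  obtain ⟨Q, f, g, hQ, -, w, hS⟩ := hK 0
  have := hS.epi_g
  obtain ⟨n, s, hs⟩ := Module.Finite.exists_fin (R := R) (M := Q)
  let p : ModuleCat.of R (ℕ →₀ R) ⟶ Q := ModuleCat.ofHom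
    (Finsupp.linearCombination R fun k : ℕ ↦ if h : k < n then s ⟨k, h⟩ else 0)
  have : Epi p := by
    rw [ModuleCat.epi_iff_range_eq_top, eq_top_iff, ← hs, Submodule.span_le]
    rintro _ ⟨i, rfl⟩
    exact ⟨Finsupp.single i.1 1, by simp [p]⟩
  exact ⟨p ≫ g, epi_comp _ _⟩

/-- Theorem 4.4(b): `Findim(R) = findim(R)` iff `pd(ω^∧) = pd(ω)` for the kernel `ω`
of the cotorsion pair generated by `𝒫^{<∞}`. -/
theorem stmt5 {R : Type u} [Ring R] [IsNoetherianRing R]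
    (hfd : littleFindim R < ⊤) (𝒜 ℬ ω : Set (ModuleCat.{u} R))
    (hB : ℬ = rperp1 (Pfin R)) (hA : 𝒜 = lperp1 ℬ) (hω : ω = 𝒜 ∩ ℬ) :
    bigFindim R = littleFindim R ↔ pdClass (resClosure ω) = pdClass ω := by
  subst hω hA hB
  have : Projective (ModuleCat.of R (ℕ →₀ R)) := ModuleCat.projective_of_free Finsupp.basisSingleOne
  have hG := exists_epi_of_mem_Pfin (R := R)
  have hsyz := exists_syzygy_mem_Pfin (R := R)
  obtain ⟨n, hn⟩ := ENat.ne_top_iff_exists.1 hfd.ne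
  have hA : ∀ A ∈ lperp1 (rperp1 (Pfin R)), HasProjectiveDimensionLE A n := fun A hA ↦
    hasProjectiveDimensionLE_of_mem_lperp1_rperp1 hA (pdClass_le_iff.1 hn.ge)
  have hle : pdClass (lperp1 (rperp1 (Pfin R)) ∩ rperp1 (Pfin R)) ≤ n :=
    pdClass_le_iff.2 fun M hM ↦ hA M hM.1
  have hω : pdClass (lperp1 (rperp1 (Pfin R)) ∩ rperp1 (Pfin R)) = littleFindim R := by
    refine le_antisymm (hle.trans hn.le) ?_
    obtain ⟨m, hm⟩ := ENat.ne_top_iff_exists.1 (hle.trans_lt (ENat.natCast_lt_top n)).ne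
    rw [← hm]
    refine pdClass_le_iff.2 fun X hX ↦ hasProjectiveDimensionLE_of_kernel hG
      (pdClass_le_iff.1 hm.ge) n (fun A h ↦ ?_) X (subset_lperp1_rperp1 hX)
    have := hA A h
    exact hasProjectiveDimensionLT_of_ge A (n + 1) _ (by lia)
  rw [hω]
  constructor
  · intro h
    refine le_antisymm ((pdClass_mono (resClosure_subset_P fun M hM ↦ ?_)).trans h.le) ?_
    · exact pd_lt_top_iff.2 ⟨n, hA M hM.1⟩
    · rw [← hω]
      exact pdClass_mono fun M hM ↦ ⟨0, hM⟩
  · intro h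
    refine le_antisymm ?_ (pdClass_mono fun M hM ↦ hM.1)
    rw [← hn] at h ⊢
    refine pdClass_le_iff.2 fun M hM ↦ ?_
    obtain ⟨k, hk⟩ := pd_lt_top_iff.1 hM
    obtain ⟨B, A, f, g, hB, hA', w, hS⟩ := exists_special_preenvelope hG M
    have hA' := hA A hA'
    have hB' : HasProjectiveDimensionLT B (n + k + 1) := hS.hasProjectiveDimensionLT_X₂ _
      (hasProjectiveDimensionLT_of_ge M (k + 1) _ (by lia))
      (hasProjectiveDimensionLT_of_ge A (n + 1) _ (by lia))
    have hBn : HasProjectiveDimensionLE B n := pdClass_le_iff.1 h.le B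
      ⟨n + k, hasResLen_of_subsingleton_ext hG hsyz hB _ fun N _ ↦
        HasProjectiveDimensionLT.subsingleton B (n + k + 1) _ le_rfl N⟩
    exact hS.hasProjectiveDimensionLT_X₁ (n + 1) hBn
      (hasProjectiveDimensionLT_of_ge A (n + 1) _ (by lia))

end CotorsionDim
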